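/- Let h : ℝⁿ → ℝ be a C² function with h(x) ≥ 1 for all x. Then for every smooth compactly supported function f : ℝⁿ → ℝ, ∫ (−Lh/h) f² dμ ≤ ∫ |∇f|² dμ. -/

import Mathlib

open MeasureTheory Real Set
open scoped ENNReal RealInnerProductSpace

noncomputable section

abbrev En (n : ℕ) := EuclideanSpace ℝ (Fin n)

/-- The Laplacian on `ℝⁿ`: sum of second partial derivatives. -/
def lapl {n : ℕ} (g : En n → ℝ) (x : En n) : ℝ :=
  ∑ i : Fin n,
    fderiv ℝ (fun y => fderiv ℝ g y (EuclideanSpace.single i 1)) x (EuclideanSpace.single i 1)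

/-- The diffusion operator `L g = Δ g - ∇V · ∇g`. -/
def Lop {n : ℕ} (V g : En n → ℝ) (x : En n) : ℝ :=
  lapl g x - ⟪gradient V x, gradient g x⟫

/-- The Boltzmann measure `dμ = e^{-V}/Z dx`. -/
def boltz {n : ℕ} (V : En n → ℝ) : Measure (En n) :=
  (volume : Measure (En n)).withDensity
    (fun x => ENNReal.ofReal (Real.exp (-V x) / ∫ y, Real.exp (-V y)))

/-- In coordinates, the inner product of gradients is the sum of products of partial derivatives. -/
theorem inner_gradient_eq_sum {n : ℕ} (u v : En n → ℝ) (x : En n) :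
    ⟪gradient u x, gradient v x⟫ = ∑ i : Fin n,
      fderiv ℝ u x (EuclideanSpace.single i 1) * fderiv ℝ v x (EuclideanSpace.single i 1) := by
  have key (g : En n → ℝ) (i : Fin n) :
      fderiv ℝ g x (EuclideanSpace.single i 1) = gradient g x i := by
    rw [← toDual_gradient, InnerProductSpace.toDual_apply_apply,
      EuclideanSpace.inner_single_right]
    simp
  simp only [key, PiLp.inner_apply]
  exact Finset.sum_congr rfl fun i _ => by simp [mul_comm]

/-- The integral of a directional derivative of a compactly supported `C¹` function vanishes. -/
theorem integral_fderiv_apply_eq_zero {n : ℕ} {F : En n → ℝ} (hF : ContDiff ℝ 1 F)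
    (hFc : HasCompactSupport F) (v : En n) : ∫ x, fderiv ℝ F x v = 0 := by
  have hd : Integrable (fun x => fderiv ℝ F x v) :=
    ((hF.continuous_fderiv one_ne_zero).clm_apply continuous_const).integrable_of_hasCompactSupport
      (hFc.fderiv_apply ℝ v)
  have := integral_mul_fderiv_eq_neg_fderiv_mul_of_integrable (μ := (volume : Measure (En n)))
    (f := fun _ => (1 : ℝ)) (g := F) (v := v) (by simp) (by simpa using hd)
    (by simpa using hF.continuous.integrable_of_hasCompactSupport hFc)
    (fun x _ => differentiableAt_const _) (fun x _ => hF.differentiable one_ne_zero x)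
  simpa using this

/-- Integration against `boltz V` is integration against its Lebesgue density. -/
theorem integral_boltz {n : ℕ} {V : En n → ℝ} (hV : Continuous V) (g : En n → ℝ) :
    ∫ x, g x ∂(boltz V) = ∫ x, Real.exp (-V x) / (∫ y, Real.exp (-V y)) * g x := by
  have hm : Measurable fun x => ENNReal.ofReal (Real.exp (-V x) / ∫ y, Real.exp (-V y)) :=
    ((Real.continuous_exp.comp hV.neg).div_const _).measurable.ennreal_ofReal
  rw [boltz, integral_withDensity_eq_integral_toReal_smul hm
    (Filter.Eventually.of_forall fun _ => ENNReal.ofReal_lt_top)]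
  refine integral_congr_ae (Filter.Eventually.of_forall fun x => ?_)
  have : 0 ≤ Real.exp (-V x) / ∫ y, Real.exp (-V y) :=
    div_nonneg (Real.exp_pos _).le (integral_nonneg fun _ => (Real.exp_pos _).le)
  simp [ENNReal.toReal_ofReal this]

/-- Derivative of one component of the vector field `e^{-V}/c · f² · ∇h/h`. -/
theorem fderiv_weighted_field {n : ℕ} {V h f G : En n → ℝ} {x : En n} (c : ℝ) (v : En n)
    (hV : DifferentiableAt ℝ V x) (hh : DifferentiableAt ℝ h x) (hf : DifferentiableAt ℝ f x)
    (hG : DifferentiableAt ℝ G x) (hx : h x ≠ 0) :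
    fderiv ℝ (fun y => Real.exp (-V y) / c * (f y ^ 2 * (G y / h y))) x v =
      Real.exp (-V x) / c * (f x ^ 2 * ((fderiv ℝ G x v - fderiv ℝ V x v * G x) / h x)
        + 2 * f x * fderiv ℝ f x v * (G x / h x)
        - f x ^ 2 * G x * fderiv ℝ h x v / h x ^ 2) := by
  have hinv : HasFDerivAt (fun y => (h y)⁻¹) (-(h x ^ 2)⁻¹ • fderiv ℝ h x) x :=
    (hasDerivAt_inv hx).comp_hasFDerivAt x hh.hasFDerivAt
  have H := (hV.hasFDerivAt.neg.exp.mul_const c⁻¹).mul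
    ((hf.hasFDerivAt.pow 2).mul (hG.hasFDerivAt.mul hinv))
  refine (congrArg (fun T : En n →L[ℝ] ℝ => T v) (HasFDerivAt.fderiv H)).trans ?_
  simp
  field_simp
  ring

/-- key Lemma, unweighted form: if `h ≥ 1` is `C²`, then for every smooth
compactly supported `f`, `∫ (-Lh/h) f² dμ ≤ ∫ |∇f|² dμ`. -/
theorem stmt1 {n : ℕ} (hn : 0 < n) (V : En n → ℝ) (hV : ContDiff ℝ 2 V)
    (hVint : Integrable (fun x => Real.exp (-V x)))
    (h : En n → ℝ) (hh : ContDiff ℝ 2 h) (hh1 : ∀ x, 1 ≤ h x)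
    (f : En n → ℝ) (hf : ContDiff ℝ (⊤ : ℕ∞) f) (hfc : HasCompactSupport f) :
    ∫ x, (-(Lop V h x) / h x) * (f x) ^ 2 ∂(boltz V)
      ≤ ∫ x, ‖gradient f x‖ ^ 2 ∂(boltz V) := by
  rw [integral_boltz hV.continuous, integral_boltz hV.continuous]
  set c := ∫ y, Real.exp (-V y) with hc
  have hc0 : 0 ≤ c := integral_nonneg fun _ => (Real.exp_pos _).le
  have hne (x) : h x ≠ 0 := (zero_lt_one.trans_le (hh1 x)).ne'
  have hdV : Differentiable ℝ V := hV.differentiable two_ne_zero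
  have hdh : Differentiable ℝ h := hh.differentiable two_ne_zero
  have hf1 : ContDiff ℝ 1 f := hf.of_le (by exact_mod_cast le_top)
  have hdf : Differentiable ℝ f := hf1.differentiable one_ne_zero
  have partial_contDiff (v : En n) : ContDiff ℝ 1 fun y => fderiv ℝ h y v :=
    (hh.fderiv_right (m := 1) (by norm_num)).clm_apply contDiff_const
  have partial_cont {g : En n → ℝ} (hg : ContDiff ℝ 1 g) (v : En n) :
      Continuous fun y => fderiv ℝ g y v :=
    (hg.continuous_fderiv one_ne_zero).clm_apply continuous_const
  have hw : Continuous fun x => Real.exp (-V x) / c :=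
    (Real.continuous_exp.comp hV.continuous.neg).div_const _
  let F (i : Fin n) (y : En n) : ℝ := Real.exp (-V y) / c *
    (f y ^ 2 * (fderiv ℝ h y (EuclideanSpace.single i 1) / h y))
  have hFsmooth (i) : ContDiff ℝ 1 (F i) :=
    ((Real.contDiff_exp.comp (hV.of_le one_le_two).neg).div_const _).mul
      ((hf1.pow 2).mul ((partial_contDiff _).div (hh.of_le one_le_two) hne))
  have hfz {x : En n} (hx : x ∉ tsupport f) : f x = 0 := image_eq_zero_of_notMem_tsupport hx
  have hFc (i) : HasCompactSupport (F i) :=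
    HasCompactSupport.intro hfc fun x hx => by simp [F, hfz hx]
  have hFint (i) : Integrable fun x => fderiv ℝ (F i) x (EuclideanSpace.single i 1) :=
    (partial_cont (hFsmooth i) _).integrable_of_hasCompactSupport ((hFc i).fderiv_apply ℝ _)
  have hLcont : Continuous fun x => Lop V h x := by
    simp only [Lop, lapl, inner_gradient_eq_sum]
    exact (continuous_finsetSum _ fun i _ => partial_cont (partial_contDiff _) _).sub
      (continuous_finsetSum _ fun i _ => (partial_cont (hV.of_le one_le_two) _).mul
        (partial_contDiff _).continuous)
  have hLint : Integrable fun x =>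
      Real.exp (-V x) / c * (-(Lop V h x) / h x * f x ^ 2) :=
    (hw.mul ((hLcont.neg.div hh.continuous hne).mul
      (hf.continuous.pow 2))).integrable_of_hasCompactSupport
      (HasCompactSupport.intro hfc fun x hx => by simp [hfz hx])
  have hnorm (x) : ‖gradient f x‖ ^ 2 = ∑ i : Fin n,
      fderiv ℝ f x (EuclideanSpace.single i 1) * fderiv ℝ f x (EuclideanSpace.single i 1) := by
    rw [← inner_gradient_eq_sum, real_inner_self_eq_norm_sq]
  have hRint : Integrable fun x => Real.exp (-V x) / c * ‖gradient f x‖ ^ 2 := by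
    refine Continuous.integrable_of_hasCompactSupport ?_ ?_
    · simp only [hnorm]
      exact hw.mul (continuous_finsetSum _ fun i _ =>
        (partial_cont hf1 _).mul (partial_cont hf1 _))
    · refine HasCompactSupport.intro (hfc.fderiv ℝ) fun x hx => ?_
      simp [hnorm, image_eq_zero_of_notMem_tsupport hx]
  have hpoint (x) : Real.exp (-V x) / c * (-(Lop V h x) / h x * f x ^ 2)
      + ∑ i, fderiv ℝ (F i) x (EuclideanSpace.single i 1)
      ≤ Real.exp (-V x) / c * ‖gradient f x‖ ^ 2 := by
    have hFi (i) := fderiv_weighted_field c (EuclideanSpace.single i 1) (hdV x) (hdh x) (hdf x)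
      ((partial_contDiff (EuclideanSpace.single i 1)).differentiable one_ne_zero x) (hne x)
    simp only [F, hFi, hnorm, Lop, lapl, inner_gradient_eq_sum]
    rw [← Finset.mul_sum, ← mul_add]
    refine mul_le_mul_of_nonneg_left ?_ (div_nonneg (Real.exp_pos _).le hc0)
    rw [← Finset.sum_sub_distrib, ← Finset.sum_neg_distrib, Finset.sum_div, Finset.sum_mul,
      ← Finset.sum_add_distrib]
    refine Finset.sum_le_sum fun i _ => ?_
    have hsq := sq_nonneg (fderiv ℝ f x (EuclideanSpace.single i 1)
      - f x * fderiv ℝ h x (EuclideanSpace.single i 1) / h x)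
    rw [← sub_nonneg]
    convert hsq using 1
    have := hne x
    field_simp
    ring
  calc ∫ x, Real.exp (-V x) / c * (-(Lop V h x) / h x * f x ^ 2)
      = ∫ x, (Real.exp (-V x) / c * (-(Lop V h x) / h x * f x ^ 2)
          + ∑ i, fderiv ℝ (F i) x (EuclideanSpace.single i 1)) := by
        rw [integral_add hLint (integrable_finsetSum _ fun i _ => hFint i),
          integral_finsetSum _ fun i _ => hFint i]
        simp [integral_fderiv_apply_eq_zero (hFsmooth _) (hFc _)]
    _ ≤ ∫ x, Real.exp (-V x) / c * ‖gradient f x‖ ^ 2 :=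
        integral_mono (hLint.add (integrable_finsetSum _ fun i _ => hFint i)) hRint hpoint
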